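/- arXiv:math/0505184 — 4 statements merged into one kernel-verified Lean document; each statement's English description precedes it below -/
import Mathlib

section
/- Let W be a standard normal random variable with density h₂(x) = e^{−x²/2}/√(2π), and let γ > 0 and r > 0. For s ≥ 0 set M_{γ,s} = E[|W|^s 1_{{|W| ≤ γ}}]. Then the function u ↦ E[|uW|^r 1_{{|uW| ≤ γ}}], defined for u > 0, is differentiable at u = 1 with derivative equal to r M_{γ,r} − 2 h₂(γ) γ^{r+1}. -/
open MeasureTheory ProbabilityTheory

/-- The truncated absolute moments of the standard normal law as interval integrals. -/
lemma integral_gaussianReal_truncated_power (r : ℝ) {a : ℝ} (ha : 0 ≤ a) :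
    ∫ x, (if |x| ≤ a then |x| ^ r else 0) ∂(gaussianReal 0 1) =
      ∫ x in (-a)..a, gaussianPDFReal 0 1 x * |x| ^ r := by
  rw [integral_gaussianReal_eq_integral_smul one_ne_zero,
    intervalIntegral.integral_of_le (by linarith), ← integral_Icc_eq_integral_Ioc,
    ← integral_indicator measurableSet_Icc]
  refine integral_congr_ae (.of_forall fun x ↦ ?_)
  simp [Set.indicator_apply, abs_le]

/-- Scaling relation for the truncated power moments. -/
lemma integral_gaussianReal_truncated_power_mul (γ r : ℝ) {u : ℝ} (hu : 0 < u) :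
    ∫ x, (if |u * x| ≤ γ then |u * x| ^ r else 0) ∂(gaussianReal 0 1) =
      u ^ r * ∫ x, (if |x| ≤ γ / u then |x| ^ r else 0) ∂(gaussianReal 0 1) := by
  rw [← integral_const_mul]
  congr with x
  simp only [abs_mul, abs_of_pos hu, le_div_iff₀' hu, mul_ite, mul_zero,
    Real.mul_rpow hu.le (abs_nonneg x)]

/-- Derivative of the integral of a continuous function over a symmetric interval. -/
lemma Continuous.hasDerivAt_integral_neg_self {g : ℝ → ℝ} (hg : Continuous g) (a : ℝ) :
    HasDerivAt (fun b ↦ ∫ x in (-b)..b, g x) (g a + g (-a)) a := by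
  have h (b : ℝ) : HasDerivAt (fun c ↦ ∫ x in (0 : ℝ)..c, g x) (g b) b :=
    hg.integral_hasStrictDerivAt 0 b |>.hasDerivAt
  have hsub := (h a).sub ((h (-a)).comp a (hasDerivAt_neg a))
  refine (hsub.congr_deriv (by ring)).congr_of_eventuallyEq (.of_forall fun b ↦ ?_)
  exact (intervalIntegral.integral_interval_sub_left
    (hg.intervalIntegrable _ _) (hg.intervalIntegrable _ _)).symm

/-- For `W` standard normal, `γ > 0` and `r > 0`, the function
`u ↦ E[|uW|^r 1_{|uW| ≤ γ}]` is differentiable at `u = 1` with derivative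
`r M_{γ,r} − 2 h₂(γ) γ^{r+1}`, where `M_{γ,s} = E[|W|^s 1_{|W| ≤ γ}]` and
`h₂` is the standard normal density.  This is `Ψ'_{k_γ}(1, 0)` in formula (91). -/
theorem hasDerivAt_truncated_power_moment (γ r : ℝ) (hγ : 0 < γ) (hr : 0 < r) :
    HasDerivAt
      (fun u : ℝ => ∫ x, (if |u * x| ≤ γ then |u * x| ^ r else 0) ∂(gaussianReal 0 1))
      (r * (∫ x, (if |x| ≤ γ then |x| ^ r else 0) ∂(gaussianReal 0 1)) -
        2 * (Real.exp (-(γ ^ 2) / 2) / Real.sqrt (2 * Real.pi)) * γ ^ (r + 1))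
      1 := by
  set g : ℝ → ℝ := fun x ↦ gaussianPDFReal 0 1 x * |x| ^ r with hg_def
  have hg : Continuous g := by
    refine Continuous.mul ?_ (continuous_abs.rpow_const fun _ ↦ .inr hr.le)
    unfold gaussianPDFReal
    fun_prop
  have hdiv : HasDerivAt (fun u : ℝ ↦ γ / u) (-γ) 1 := by
    simpa using (hasDerivAt_const (1 : ℝ) γ).fun_div (hasDerivAt_id (1 : ℝ)) one_ne_zero
  have hpow : HasDerivAt (fun u : ℝ ↦ u ^ r) r 1 := by
    simpa using Real.hasDerivAt_rpow_const (x := 1) (p := r) (.inl one_ne_zero)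
  have hcomp := HasDerivAt.comp_of_eq 1 (hg.hasDerivAt_integral_neg_self γ) hdiv (div_one γ).symm
  refine ((hpow.mul hcomp).congr_deriv ?_).congr_of_eventuallyEq ?_
  · rw [integral_gaussianReal_truncated_power r hγ.le]
    simp only [Function.comp_apply, div_one, Real.one_rpow, hg_def, gaussianPDFReal, abs_neg,
      abs_of_pos hγ, Real.rpow_add hγ, Real.rpow_one, sub_zero, neg_sq, NNReal.coe_one, mul_one]
    ring
  · filter_upwards [lt_mem_nhds one_pos] with u hu
    rw [integral_gaussianReal_truncated_power_mul γ r hu,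
      integral_gaussianReal_truncated_power r (div_pos hγ hu).le]
    rfl
end

section
/- Fix λ > highlights0, η > 0, σ > 0 and r with 0 < r < 2. Then, as Δ ↓ 0, (1/Δ) · ( ∫_ℝ |x|^r dμ_Δ(x) − (2^{r/2}/√π) Γ((1+r)/2) σ^r Δ^{r/2} ) converges to (2^{r/2}/√π) Γ((1+r)/2) λ η^{r/2}. In particular ∫ |x|^r dμ_Δ = E[|σW_Δ|^r] + o(Δ^{r/2}), and the leading bias term in the untruncated r-th power variation is of order Δ^{1−r/2} with constant proportional to λ η^{r/2}. -/
open MeasureTheory ProbabilityTheory Filter Topology Asymptotics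

/-- The law `μ_Δ` of `X_Δ = σ W_Δ + Y_Δ`, where `W` is a standard Brownian motion and
`Y` an independent compound Poisson process with intensity `λ` and `N(0, η)` jumps:
the Poisson mixture of centered Gaussians
`μ_Δ = e^{−λΔ} ∑_j ((λΔ)^j / j!) · N(0, σ²Δ + jη)`. -/
noncomputable def poissonGaussianMixture (lam eta sig Δ : ℝ) : Measure ℝ :=
  Measure.sum fun j : ℕ =>
    ENNReal.ofReal (Real.exp (-(lam * Δ)) * (lam * Δ) ^ j / j.factorial) •
      gaussianReal 0 (Real.toNNReal (sig ^ 2 * Δ + j * eta))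

theorem integral_abs_rpow_gaussianReal {r : ℝ} (hr : -1 < r) {v : NNReal} (hv : v ≠ 0) :
    ∫ x, |x| ^ r ∂(gaussianReal 0 v) =
      2 ^ (r / 2) / √Real.pi * Real.Gamma ((1 + r) / 2) * (v : ℝ) ^ (r / 2) := by
  have hv' : (0 : ℝ) < v := NNReal.coe_pos.2 (pos_iff_ne_zero.2 hv)
  have hdens (x : ℝ) : gaussianPDFReal 0 v x • |x| ^ r =
      (√(2 * Real.pi * v))⁻¹ * (|x| ^ r * Real.exp (-(2 * (v : ℝ))⁻¹ * |x| ^ (2 : ℝ))) := by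
    rw [gaussianPDFReal, Real.rpow_two, sq_abs, smul_eq_mul, sub_zero,
      show -x ^ 2 / (2 * (v : ℝ)) = -(2 * (v : ℝ))⁻¹ * x ^ 2 by field_simp]
    ring
  simp_rw [integral_gaussianReal_eq_integral_smul hv, hdens]
  rw [integral_const_mul,
    integral_comp_abs (f := fun x : ℝ ↦ x ^ r * Real.exp (-(2 * (v : ℝ))⁻¹ * x ^ (2 : ℝ))),
    integral_rpow_mul_exp_neg_mul_rpow two_pos hr (by positivity),
    Real.inv_rpow (by positivity), ← Real.rpow_neg (by positivity),
    show -(-(r + 1) / 2) = r / 2 + 1 / 2 by ring, Real.rpow_add (by positivity),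
    ← Real.sqrt_eq_rpow, Real.mul_rpow (by norm_num) hv'.le,
    show 2 * Real.pi * (v : ℝ) = Real.pi * (2 * v) by ring, Real.sqrt_mul Real.pi_pos.le,
    add_comm r 1]
  have hs : √(2 * (v : ℝ)) ≠ 0 := by positivity
  field_simp

theorem integrable_abs_rpow_gaussianReal {r : ℝ} (hr : -1 < r) {v : NNReal} (hv : v ≠ 0) :
    Integrable (fun x : ℝ ↦ |x| ^ r) (gaussianReal 0 v) := by
  refine .of_integral_ne_zero ?_
  rw [integral_abs_rpow_gaussianReal hr hv]
  have hv' : (0 : ℝ) < v := NNReal.coe_pos.2 (pos_iff_ne_zero.2 hv)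
  have hΓ := Real.Gamma_pos_of_pos (show 0 < (1 + r) / 2 by linarith)
  positivity

theorem summable_pow_div_factorial_mul_affine (x a b : ℝ) :
    Summable fun j : ℕ ↦ x ^ j / j.factorial * (a + j * b) := by
  have hlin : Summable fun j : ℕ ↦ x ^ j / j.factorial * j := by
    rw [← summable_nat_add_iff 1]
    refine ((Real.summable_pow_div_factorial x).mul_left x).congr fun j ↦ ?_
    rw [Nat.factorial_succ]
    push_cast
    field_simp
    ring
  refine (((Real.summable_pow_div_factorial x).mul_right a).add (hlin.mul_right b)).congr
    fun j ↦ ?_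
  ring

theorem rpow_le_one_add {x p : ℝ} (hx : 0 ≤ x) (hp : 0 ≤ p) (hp1 : p ≤ 1) :
    x ^ p ≤ 1 + x :=
  calc x ^ p ≤ (1 + x) ^ p := by gcongr; linarith
    _ ≤ (1 + x) ^ (1 : ℝ) := Real.rpow_le_rpow_of_exponent_le (by linarith) hp1
    _ = 1 + x := Real.rpow_one _

theorem summable_pow_div_factorial_mul_affine_rpow {x a b p : ℝ} (hx : 0 ≤ x) (ha : 0 ≤ a)
    (hb : 0 ≤ b) (hp : 0 ≤ p) (hp1 : p ≤ 1) :
    Summable fun j : ℕ ↦ x ^ j / j.factorial * (a + j * b) ^ p := by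
  refine (summable_pow_div_factorial_mul_affine x (1 + a) b).of_nonneg_of_le
    (fun j ↦ by positivity) fun j ↦ ?_
  rw [add_assoc]
  gcongr
  exact rpow_le_one_add (by positivity) hp hp1

theorem integral_abs_rpow_poissonGaussianMixture {lam eta sig r Δ : ℝ} (hlam : 0 < lam)
    (heta : 0 < eta) (hsig : 0 < sig) (hr : 0 < r) (hr2 : r < 2) (hΔ : 0 < Δ) :
    ∫ x, |x| ^ r ∂(poissonGaussianMixture lam eta sig Δ) =
      2 ^ (r / 2) / √Real.pi * Real.Gamma ((1 + r) / 2) * Real.exp (-(lam * Δ)) *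
        ∑' j : ℕ, (lam * Δ) ^ j / j.factorial * (sig ^ 2 * Δ + j * eta) ^ (r / 2) := by
  have hvar (j : ℕ) : 0 < sig ^ 2 * Δ + j * eta := by positivity
  have hvar' (j : ℕ) : Real.toNNReal (sig ^ 2 * Δ + j * eta) ≠ 0 :=
    (Real.toNNReal_pos.2 (hvar j)).ne'
  have hterm (j : ℕ) :
      ∫ x, |x| ^ r ∂(ENNReal.ofReal (Real.exp (-(lam * Δ)) * (lam * Δ) ^ j / j.factorial) •
        gaussianReal 0 (Real.toNNReal (sig ^ 2 * Δ + j * eta))) =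
      2 ^ (r / 2) / √Real.pi * Real.Gamma ((1 + r) / 2) * Real.exp (-(lam * Δ)) *
        ((lam * Δ) ^ j / j.factorial * (sig ^ 2 * Δ + j * eta) ^ (r / 2)) := by
    rw [integral_smul_measure, integral_abs_rpow_gaussianReal (by linarith) (hvar' j),
      ENNReal.toReal_ofReal (by positivity), Real.coe_toNNReal _ (hvar j).le, smul_eq_mul]
    ring
  have hmix : Integrable (fun x : ℝ ↦ |x| ^ r) (poissonGaussianMixture lam eta sig Δ) := by
    refine integrable_sum_measure (fun j ↦ (integrable_abs_rpow_gaussianReal (by linarith)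
      (hvar' j)).smul_measure ENNReal.ofReal_ne_top) ?_
    have hnorm (x : ℝ) : ‖|x| ^ r‖ = |x| ^ r := Real.norm_of_nonneg (by positivity)
    simp_rw [hnorm, hterm]
    exact (summable_pow_div_factorial_mul_affine_rpow (by positivity) (by positivity)
      heta.le (by linarith) (by linarith)).mul_left _
  rw [poissonGaussianMixture] at hmix ⊢
  rw [integral_sum_measure hmix]
  simp_rw [hterm]
  exact tsum_mul_left

/-- The normalised contribution of at least one jump is dominated by that of exactly one jump. -/
theorem tendsto_tsum_jump_terms {lam a eta p : ℝ} (hlam : 0 < lam) (ha : 0 ≤ a)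
    (heta : 0 < eta) (hp : 0 ≤ p) (hp1 : p ≤ 1) :
    Tendsto (fun Δ : ℝ ↦ ∑' j : ℕ, lam ^ (j + 1) * Δ ^ j / (j + 1).factorial *
      (a * Δ + (j + 1 : ℕ) * eta) ^ p) (𝓝[>] 0) (𝓝 (lam * eta ^ p)) := by
  have hlim (j : ℕ) : Tendsto (fun Δ : ℝ ↦ lam ^ (j + 1) * Δ ^ j / (j + 1).factorial *
      (a * Δ + (j + 1 : ℕ) * eta) ^ p) (𝓝[>] 0) (𝓝 (if j = 0 then lam * eta ^ p else 0)) := by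
    have hcont : Continuous fun Δ : ℝ ↦ lam ^ (j + 1) * Δ ^ j / (j + 1).factorial *
        (a * Δ + (j + 1 : ℕ) * eta) ^ p :=
      (by fun_prop : Continuous fun Δ : ℝ ↦ lam ^ (j + 1) * Δ ^ j / (j + 1).factorial).mul
        ((by fun_prop : Continuous fun Δ : ℝ ↦ a * Δ + (j + 1 : ℕ) * eta).rpow_const
          fun _ ↦ Or.inr hp)
    refine (hcont.tendsto' 0 _ ?_).mono_left nhdsWithin_le_nhds
    rcases j with _ | j <;> simp
  have hbound : Summable fun j : ℕ ↦
      lam ^ (j + 1) / (j + 1).factorial * (1 + a + (j + 1 : ℕ) * eta) :=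
    (summable_nat_add_iff 1).2 (summable_pow_div_factorial_mul_affine lam (1 + a) eta)
  have key := tendsto_tsum_of_dominated_convergence hbound hlim (by
    filter_upwards [Ioc_mem_nhdsGT one_pos] with Δ ⟨hΔ, hΔ1⟩ j
    rw [Real.norm_of_nonneg (by positivity), add_assoc]
    have hpow : lam ^ (j + 1) * Δ ^ j ≤ lam ^ (j + 1) :=
      mul_le_of_le_one_right (by positivity) (pow_le_one₀ hΔ.le hΔ1)
    have haΔ : a * Δ ≤ a := mul_le_of_le_one_right ha hΔ1
    gcongr
    refine (rpow_le_one_add (by positivity) hp hp1).trans ?_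
    gcongr)
  rwa [tsum_ite_eq] at key

/-- For `0 < r < 2`, as `Δ ↓ 0`,
`(1/Δ)(∫ |x|^r dμ_Δ − (2^{r/2}/√π) Γ((1+r)/2) σ^r Δ^{r/2})`
converges to `(2^{r/2}/√π) Γ((1+r)/2) λ η^{r/2}`; in particular
`∫ |x|^r dμ_Δ = E[|σW_Δ|^r] + o(Δ^{r/2})`, so the leading bias term of the
untruncated `r`-th power variation is of order `Δ^{1−r/2}` with constant
proportional to `λ η^{r/2}`. -/
theorem untruncated_moment_expansion (lam eta sig r : ℝ)
    (hlam : 0 < lam) (heta : 0 < eta) (hsig : 0 < sig) (hr : 0 < r) (hr2 : r < 2) :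
    Tendsto
      (fun Δ : ℝ => (1 / Δ) *
        ((∫ x, |x| ^ r ∂(poissonGaussianMixture lam eta sig Δ)) -
          (2 ^ (r / 2) / Real.sqrt Real.pi) * Real.Gamma ((1 + r) / 2) *
            sig ^ r * Δ ^ (r / 2)))
      (𝓝[>] 0)
      (𝓝 ((2 ^ (r / 2) / Real.sqrt Real.pi) * Real.Gamma ((1 + r) / 2) *
        lam * eta ^ (r / 2))) ∧
    (fun Δ : ℝ =>
        (∫ x, |x| ^ r ∂(poissonGaussianMixture lam eta sig Δ)) -
          (2 ^ (r / 2) / Real.sqrt Real.pi) * Real.Gamma ((1 + r) / 2) *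
            sig ^ r * Δ ^ (r / 2))
      =o[𝓝[>] 0] (fun Δ : ℝ => Δ ^ (r / 2)) := by
  have hp : 0 < r / 2 := by linarith
  set C := 2 ^ (r / 2) / √Real.pi * Real.Gamma ((1 + r) / 2) with hC
  have hexp : Tendsto (fun Δ : ℝ ↦ Real.exp (-(lam * Δ))) (𝓝[>] 0) (𝓝 1) :=
    ((by fun_prop : Continuous fun Δ : ℝ ↦ Real.exp (-(lam * Δ))).tendsto' 0 1
      (by simp)).mono_left nhdsWithin_le_nhds
  have hslope : Tendsto (fun Δ : ℝ ↦ Δ⁻¹ * (Real.exp (-(lam * Δ)) - 1)) (𝓝[>] 0)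
      (𝓝 (-lam)) := by
    have hderiv : HasDerivAt (fun Δ : ℝ ↦ Real.exp (-(lam * Δ))) (-lam) 0 := by
      simpa using ((hasDerivAt_id (0 : ℝ)).const_mul lam).neg.exp
    simpa using hderiv.tendsto_slope_zero_right
  have hrpow {q : ℝ} (hq : 0 < q) : Tendsto (fun Δ : ℝ ↦ Δ ^ q) (𝓝[>] 0) (𝓝 0) :=
    ((Real.continuous_rpow_const hq.le).tendsto' 0 0
      (Real.zero_rpow hq.ne')).mono_left nhdsWithin_le_nhds
  have hlim : Tendsto
      (fun Δ : ℝ => (1 / Δ) * ((∫ x, |x| ^ r ∂(poissonGaussianMixture lam eta sig Δ)) -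
        C * sig ^ r * Δ ^ (r / 2))) (𝓝[>] 0) (𝓝 (C * lam * eta ^ (r / 2))) := by
    have key := ((hslope.mul (hrpow hp)).const_mul (C * sig ^ r)).add
      ((hexp.mul (tendsto_tsum_jump_terms hlam (sq_nonneg sig) heta hp.le
        (by linarith))).const_mul C)
    rw [mul_zero, mul_zero, zero_add, one_mul, ← mul_assoc] at key
    refine key.congr' ?_
    filter_upwards [self_mem_nhdsWithin] with Δ (hΔ : 0 < Δ)
    rw [integral_abs_rpow_poissonGaussianMixture hlam heta hsig hr hr2 hΔ, ← hC,
      (summable_pow_div_factorial_mul_affine_rpow (by positivity) (by positivity)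
        heta.le hp.le (by linarith)).tsum_eq_zero_add]
    have hshift : ∑' j : ℕ, (lam * Δ) ^ (j + 1) / (j + 1).factorial *
          (sig ^ 2 * Δ + (j + 1 : ℕ) * eta) ^ (r / 2) =
        Δ * ∑' j : ℕ, lam ^ (j + 1) * Δ ^ j / (j + 1).factorial *
          (sig ^ 2 * Δ + (j + 1 : ℕ) * eta) ^ (r / 2) := by
      rw [← tsum_mul_left]
      congr 1 with j
      ring
    have hzero : (sig ^ 2 * Δ + (0 : ℕ) * eta) ^ (r / 2) = sig ^ r * Δ ^ (r / 2) := by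
      rw [Nat.cast_zero, zero_mul, add_zero, Real.mul_rpow (by positivity) hΔ.le,
        ← Real.rpow_natCast_mul hsig.le]
      congr 2
      push_cast
      ring
    rw [hshift, hzero, pow_zero, Nat.factorial_zero, Nat.cast_one, div_one, one_mul]
    generalize ∑' j : ℕ, lam ^ (j + 1) * Δ ^ j / (j + 1).factorial *
      (sig ^ 2 * Δ + (j + 1 : ℕ) * eta) ^ (r / 2) = S
    field_simp
    ring
  refine ⟨hlim, ?_⟩
  refine (isLittleO_iff_tendsto' ?_).2 ?_
  · filter_upwards [self_mem_nhdsWithin] with Δ (hΔ : 0 < Δ) h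
    exact absurd h (by positivity)
  · have key := hlim.mul (hrpow (show 0 < 1 - r / 2 by linarith))
    rw [mul_zero] at key
    refine key.congr' ?_
    filter_upwards [self_mem_nhdsWithin] with Δ (hΔ : 0 < Δ)
    rw [Real.rpow_sub hΔ, Real.rpow_one]
    field_simp
end

section
/- Fix λ > 0, η > 0, σ > 0, c > 0 and r with 0 < r ≤ 2, and set the truncation level τ(Δ) = c Δ^{1/2}. Then, as Δ ↓ 0, ∫_ℝ |x|^r 1_{{|x| ≤ τ(Δ)}} dμ_Δ(x) − (2^{r/2}/√π) (Γ((1+r)/2) − Γ((1+r)/2, c²/(2σ²))) σ^r Δ^{r/2} = o(Δ^{r/2}); that is, the truncated r-th absolute moment of μ_Δ coincides, up to o(Δ^{r/2}), with the truncated r-th absolute moment E[|σW_Δ|^r 1_{{|σW_Δ| ≤ τ(Δ)}}] of the Gaussian component alone. -/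
open MeasureTheory ProbabilityTheory Filter Topology Asymptotics

/-- The upper incomplete Gamma function `Γ(a, x) = ∫_x^∞ t^{a−1} e^{−t} dt`. -/
noncomputable def uGamma (a x : ℝ) : ℝ := ∫ t in Set.Ioi x, t ^ (a - 1) * Real.exp (-t)

lemma gamma_sub_uGamma {a x : ℝ} (ha : 0 < a) (hx : 0 ≤ x) :
    Real.Gamma a - uGamma a x =
      ∫ t in Set.Ioi 0, (Set.Iic x).indicator (fun t => t ^ (a - 1) * Real.exp (-t)) t := by
  have hint : IntegrableOn (fun t : ℝ => t ^ (a - 1) * Real.exp (-t)) (Set.Ioi 0) := by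
    simpa only [mul_comm] using Real.GammaIntegral_convergent ha
  have hG : Real.Gamma a = ∫ t in Set.Ioi 0, t ^ (a - 1) * Real.exp (-t) := by
    rw [Real.Gamma_eq_integral ha]
    simp only [mul_comm]
  rw [hG, uGamma, intervalIntegral.integral_Ioi_sub_Ioi hint hx,
    intervalIntegral.integral_of_le hx, setIntegral_indicator measurableSet_Iic,
    Set.Ioi_inter_Iic]

/-- The truncated absolute moment of a centered Gaussian of variance `v`. -/
lemma integral_truncated_rpow_gaussianReal {r τ : ℝ} {v : NNReal} (hr : 0 < r) (hτ : 0 < τ)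
    (hv : 0 < v) :
    ∫ x, (if |x| ≤ τ then |x| ^ r else 0) ∂(gaussianReal 0 v) =
      (2 * v : ℝ) ^ (r / 2) / √Real.pi *
        (Real.Gamma ((1 + r) / 2) - uGamma ((1 + r) / 2) (τ ^ 2 / (2 * v))) := by
  have hv' : (0 : ℝ) < v := hv
  have hs : 0 < √(2 * v : ℝ) := by positivity
  have hs2 : √(2 * v : ℝ) ^ 2 = 2 * v := Real.sq_sqrt (by positivity)
  set s := √(2 * v : ℝ) with hsdef
  have hpow : (2 * v : ℝ) ^ (r / 2) = s ^ r := by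
    rw [← hs2, ← Real.rpow_natCast_mul hs.le]
    congr 1
    push_cast
    ring
  set h : ℝ → ℝ := (Set.Iic (τ ^ 2 / (2 * v : ℝ))).indicator
    (fun t => t ^ ((1 + r) / 2 - 1) * Real.exp (-t)) with hh
  have hsub : ∫ t in Set.Ioi 0, h t =
      s⁻¹ * ∫ y in Set.Ioi 0, (2 * (s⁻¹ * y) ^ ((2 : ℝ) - 1)) * h ((s⁻¹ * y) ^ (2 : ℝ)) := by
    have hc := integral_comp_mul_left_Ioi
      (fun y => (2 * y ^ ((2 : ℝ) - 1)) * h (y ^ (2 : ℝ))) 0 (inv_pos.2 hs)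
    rw [hc, ← integral_comp_rpow_Ioi_of_pos (g := h) (p := 2) two_pos]
    simp only [smul_eq_mul, mul_zero, inv_inv]
    field_simp
  set f : ℝ → ℝ := fun y =>
    (√(2 * Real.pi * v))⁻¹ * Real.exp (-y ^ 2 / (2 * v)) * (if y ≤ τ then y ^ r else 0) with hf
  have hpt : ∀ y ∈ Set.Ioi (0 : ℝ), f y =
        (√Real.pi)⁻¹ * s⁻¹ * s ^ r / 2 *
          ((2 * (s⁻¹ * y) ^ ((2 : ℝ) - 1)) * h ((s⁻¹ * y) ^ (2 : ℝ))) := by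
    intro y hy
    simp only [hf]
    have hy0 : (0 : ℝ) < y := hy
    have hky : 0 < s⁻¹ * y := by positivity
    have hsq : (s⁻¹ * y) ^ (2 : ℝ) = y ^ 2 / (2 * v) := by
      rw [Real.rpow_two, mul_pow, inv_pow, hs2]
      ring
    have hle : y ^ 2 / (2 * v : ℝ) ≤ τ ^ 2 / (2 * v : ℝ) ↔ y ≤ τ := by
      rw [div_le_div_iff_of_pos_right (by positivity), pow_le_pow_iff_left₀ hy0.le hτ.le two_ne_zero]
    by_cases hyt : y ≤ τ
    · have hmem : (s⁻¹ * y) ^ (2 : ℝ) ∈ Set.Iic (τ ^ 2 / (2 * v : ℝ)) := by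
        rw [hsq]
        exact hle.2 hyt
      have hsplit : (s⁻¹ * y) ^ ((2 : ℝ) - 1) * ((s⁻¹ * y) ^ (2 : ℝ)) ^ ((1 + r) / 2 - 1) =
          s⁻¹ ^ r * y ^ r := by
        rw [← Real.rpow_mul hky.le, ← Real.rpow_add hky, ← Real.mul_rpow (by positivity) hy0.le]
        congr 1
        ring
      have hroot : √(2 * Real.pi * v) = √Real.pi * s := by
        rw [hsdef, ← Real.sqrt_mul Real.pi_pos.le]
        congr 1
        ring
      have hexp : -y ^ 2 / (2 * v : ℝ) = -(s⁻¹ * y) ^ (2 : ℝ) := by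
        rw [hsq]
        ring
      have hsr : s ^ r * s⁻¹ ^ r = 1 := by
        rw [← Real.mul_rpow hs.le (by positivity), mul_inv_cancel₀ hs.ne', Real.one_rpow]
      rw [if_pos hyt, hh, Set.indicator_of_mem hmem, hroot, hexp, mul_inv]
      linear_combination (-(√Real.pi)⁻¹ * s⁻¹ * Real.exp (-(s⁻¹ * y) ^ (2 : ℝ))) *
        (s ^ r * hsplit + y ^ r * hsr)
    · have hmem : (s⁻¹ * y) ^ (2 : ℝ) ∉ Set.Iic (τ ^ 2 / (2 * v : ℝ)) := by
        rw [hsq]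
        exact fun H => hyt (hle.1 H)
      rw [if_neg hyt, hh, Set.indicator_of_notMem hmem]
      simp
  rw [integral_gaussianReal_eq_integral_smul hv.ne',
    gamma_sub_uGamma (by positivity) (by positivity), ← hh, hsub, hpow]
  have habs : ∀ x : ℝ, gaussianPDFReal 0 v x • (if |x| ≤ τ then |x| ^ r else 0) =
      f |x| := by
    intro x
    simp [gaussianPDFReal, hf]
  rw [integral_congr_ae (ae_of_all _ habs), integral_comp_abs,
    setIntegral_congr_fun measurableSet_Ioi hpt, integral_const_mul]
  ring

lemma hasSum_poisson_weights {t : ℝ} (ht : 0 ≤ t) :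
    HasSum (fun j : ℕ => Real.exp (-t) * t ^ j / j.factorial) 1 :=
  hasSum_one_poissonMeasure ⟨t, ht⟩

lemma isProbabilityMeasure_poissonGaussianMixture {lam Δ : ℝ} (eta sig : ℝ) (h : 0 ≤ lam * Δ) :
    IsProbabilityMeasure (poissonGaussianMixture lam eta sig Δ) := by
  constructor
  have hp := hasSum_poisson_weights h
  rw [poissonGaussianMixture, Measure.sum_apply _ MeasurableSet.univ]
  simp only [Measure.smul_apply, measure_univ, smul_eq_mul, mul_one]
  rw [← ENNReal.ofReal_tsum_of_nonneg (fun j => by positivity) hp.summable, hp.tsum_eq,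
    ENNReal.ofReal_one]

/-- For a bounded nonnegative function, replacing the mixture by its component without jumps
costs at most the bound times the probability of at least one jump. -/
lemma abs_integral_poissonGaussianMixture_sub_le {lam Δ C : ℝ} (eta sig : ℝ) (h : 0 ≤ lam * Δ)
    {g : ℝ → ℝ} (hg : Measurable g) (hg0 : ∀ x, 0 ≤ g x) (hgC : ∀ x, g x ≤ C) :
    |∫ x, g x ∂(poissonGaussianMixture lam eta sig Δ) -
        ∫ x, g x ∂(gaussianReal 0 (Real.toNNReal (sig ^ 2 * Δ)))| ≤
      C * (1 - Real.exp (-(lam * Δ))) := by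
  have := isProbabilityMeasure_poissonGaussianMixture eta sig h
  have hnorm : ∀ x, ‖g x‖ ≤ C := fun x => by
    rw [Real.norm_of_nonneg (hg0 x)]
    exact hgC x
  have hp := hasSum_poisson_weights h
  set p : ℕ → ℝ := fun j => Real.exp (-(lam * Δ)) * (lam * Δ) ^ j / j.factorial with hpdef
  have hp0 : ∀ j, 0 ≤ p j := fun j => by positivity
  set G : ℕ → ℝ := fun j => ∫ x, g x ∂(gaussianReal 0 (Real.toNNReal (sig ^ 2 * Δ + j * eta)))
    with hGdef
  have hGnonneg : ∀ j, 0 ≤ G j := fun j => integral_nonneg hg0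
  have hGle : ∀ j, G j ≤ C := fun j => by
    have := norm_integral_le_of_norm_le_const
      (μ := gaussianReal 0 (Real.toNNReal (sig ^ 2 * Δ + j * eta))) (ae_of_all _ hnorm)
    rw [probReal_univ, mul_one] at this
    exact (le_abs_self _).trans this
  have hint : Integrable g (poissonGaussianMixture lam eta sig Δ) :=
    Integrable.of_bound hg.aestronglyMeasurable C (ae_of_all _ hnorm)
  have hsum : HasSum (fun j => p j * G j) (∫ x, g x ∂(poissonGaussianMixture lam eta sig Δ)) := by
    have := hasSum_integral_measure hint
    simp only [integral_smul_measure, smul_eq_mul] at this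
    convert! this using 3 with j
    exact (ENNReal.toReal_ofReal (hp0 j)).symm
  have hG0 : ∫ x, g x ∂(gaussianReal 0 (Real.toNNReal (sig ^ 2 * Δ))) = G 0 := by
    simp [hGdef]
  have hdiff := hsum.sub (hp.mul_right (G 0))
  have hbound := (hp.sub (hasSum_ite_eq 0 (Real.exp (-(lam * Δ))))).mul_left C
  rw [hG0, ← one_mul (G 0), ← Real.norm_eq_abs]
  refine hdiff.norm_le_of_bounded hbound fun j => ?_
  rcases eq_or_ne j 0 with rfl | hj
  · simp [hpdef]
  · rw [← mul_sub, norm_mul, Real.norm_of_nonneg (hp0 j), if_neg hj, sub_zero, mul_comm C]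
    refine mul_le_mul_of_nonneg_left ?_ (hp0 j)
    rw [Real.norm_eq_abs, abs_sub_le_iff]
    constructor <;> linarith [hGnonneg j, hGle j, hGnonneg 0, hGle 0]

/-- With truncation level `τ(Δ) = c Δ^{1/2}`, for `0 < r ≤ 2`, as `Δ ↓ 0` the
truncated `r`-th absolute moment of `μ_Δ` coincides up to `o(Δ^{r/2})` with the
truncated `r`-th absolute moment of the Gaussian component alone:
`∫ |x|^r 1_{|x| ≤ cΔ^{1/2}} dμ_Δ`
`− (2^{r/2}/√π)(Γ((1+r)/2) − Γ((1+r)/2, c²/(2σ²))) σ^r Δ^{r/2} = o(Δ^{r/2})`. -/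
theorem truncated_moment_expansion (lam eta sig c r : ℝ)
    (hlam : 0 < lam) (heta : 0 < eta) (hsig : 0 < sig) (hc : 0 < c)
    (hr : 0 < r) (hr2 : r ≤ 2) :
    (fun Δ : ℝ =>
        (∫ x, (if |x| ≤ c * Real.sqrt Δ then |x| ^ r else 0)
            ∂(poissonGaussianMixture lam eta sig Δ)) -
          (2 ^ (r / 2) / Real.sqrt Real.pi) *
            (Real.Gamma ((1 + r) / 2) -
              uGamma ((1 + r) / 2) (c ^ 2 / (2 * sig ^ 2))) *
            sig ^ r * Δ ^ (r / 2))
      =o[𝓝[>] 0] (fun Δ : ℝ => Δ ^ (r / 2)) := by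
  refine IsLittleO.of_bound fun ε hε => ?_
  have hlim : Tendsto (fun Δ : ℝ => c ^ r * (1 - Real.exp (-(lam * Δ)))) (𝓝[>] 0) (𝓝 0) := by
    have hcont : Continuous fun Δ : ℝ => c ^ r * (1 - Real.exp (-(lam * Δ))) := by fun_prop
    have := hcont.tendsto 0
    simp only [mul_zero, neg_zero, Real.exp_zero, sub_self] at this
    exact this.mono_left nhdsWithin_le_nhds
  filter_upwards [hlim.eventually_lt_const hε, self_mem_nhdsWithin] with Δ hsmall hpos
  have hΔ : (0 : ℝ) < Δ := hpos
  have hτ : 0 < c * √Δ := by positivity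
  have hv : 0 < Real.toNNReal (sig ^ 2 * Δ) := Real.toNNReal_pos.2 (by positivity)
  have hvcoe : ((Real.toNNReal (sig ^ 2 * Δ) : NNReal) : ℝ) = sig ^ 2 * Δ :=
    Real.coe_toNNReal _ (by positivity)
  have hτr : (c * √Δ) ^ r = c ^ r * Δ ^ (r / 2) := by
    rw [Real.mul_rpow hc.le (by positivity), Real.sqrt_eq_rpow, ← Real.rpow_mul hΔ.le]
    congr 2
    ring
  have hgauss := integral_truncated_rpow_gaussianReal hr hτ hv
  have hratio : (c * √Δ) ^ 2 / (2 * (sig ^ 2 * Δ)) = c ^ 2 / (2 * sig ^ 2) := by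
    rw [mul_pow, Real.sq_sqrt hΔ.le]
    field_simp
  have hscale : (2 * (sig ^ 2 * Δ)) ^ (r / 2) = 2 ^ (r / 2) * sig ^ r * Δ ^ (r / 2) := by
    rw [Real.mul_rpow two_pos.le (by positivity), Real.mul_rpow (by positivity) hΔ.le,
      ← Real.rpow_natCast_mul hsig.le, ← mul_assoc]
    congr 3
    push_cast
    ring
  rw [hvcoe, hratio, hscale] at hgauss
  have hbound := abs_integral_poissonGaussianMixture_sub_le (lam := lam) (Δ := Δ)
    (C := (c * √Δ) ^ r) eta sig (by positivity)
    (g := fun x => if |x| ≤ c * √Δ then |x| ^ r else 0)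
    (Measurable.ite (measurableSet_le (by fun_prop) (by fun_prop)) (by fun_prop) (by fun_prop))
    (fun x => by positivity)
    (fun x => by
      split_ifs with hx
      · exact Real.rpow_le_rpow (abs_nonneg x) hx hr.le
      · positivity)
  rw [hgauss, hτr] at hbound
  rw [Real.norm_eq_abs, Real.norm_of_nonneg (by positivity)]
  calc _ = _ := by
        congr 2
        ring
    _ ≤ _ := hbound
    _ = c ^ r * (1 - Real.exp (-(lam * Δ))) * Δ ^ (r / 2) := by ring
    _ ≤ ε * Δ ^ (r / 2) := by gcongr
end

section
/- For r > 0 let m_r = (2^{r/2}/√π) Γ((1+r)/2) (the r-th absolute moment of a standard normal random variable), and define Σ²(r) = (m_{2r} − m_r²)/(r² m_r²). Then Σ²(2) = 1/2, and Σ²(r) ≥ 1/2 for every r > 0; that is, among power estimating functions k(x) = |x|^r in the Gaussian case β = 2, the asymptotic variance constant Σ²(k) attains its minimum value 1/2 at r = 2. -/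
/-- `m r = (2^{r/2}/√π) Γ((1+r)/2)`, the `r`-th absolute moment of a standard normal
random variable. -/
noncomputable def stdAbsMoment (r : ℝ) : ℝ :=
  2 ^ (r / 2) / Real.sqrt Real.pi * Real.Gamma ((1 + r) / 2)

open MeasureTheory Set in
/-- The second moment of `t ^ s - A - B * t` under the Gamma density with shape `a` is nonnegative. -/
theorem gamma_quadratic_form_nonneg {a s : ℝ} (ha : 0 < a) (hs : 0 < s) (A B : ℝ) :
    0 ≤ Real.Gamma (a + 2 * s) + A ^ 2 * Real.Gamma a + B ^ 2 * Real.Gamma (a + 2)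
      - 2 * A * Real.Gamma (a + s) - 2 * B * Real.Gamma (a + s + 1)
      + 2 * A * B * Real.Gamma (a + 1) := by
  have h₁ := Real.GammaIntegral_convergent (s := a + 2 * s) (by positivity)
  have h₂ := (Real.GammaIntegral_convergent ha).const_mul (A ^ 2)
  have h₃ := (Real.GammaIntegral_convergent (s := a + 2) (by positivity)).const_mul (B ^ 2)
  have h₄ := (Real.GammaIntegral_convergent (s := a + s) (by positivity)).const_mul (2 * A)
  have h₅ := (Real.GammaIntegral_convergent (s := a + s + 1) (by positivity)).const_mul (2 * B)
  have h₆ := (Real.GammaIntegral_convergent (s := a + 1) (by positivity)).const_mul (2 * A * B)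
  rw [Real.Gamma_eq_integral (s := a + 2 * s) (by positivity), Real.Gamma_eq_integral ha,
    Real.Gamma_eq_integral (s := a + 2) (by positivity),
    Real.Gamma_eq_integral (s := a + s) (by positivity),
    Real.Gamma_eq_integral (s := a + s + 1) (by positivity),
    Real.Gamma_eq_integral (s := a + 1) (by positivity)]
  simp only [← integral_const_mul]
  rw [← integral_add' h₁ h₂, ← integral_add' (h₁.add h₂) h₃, ← integral_sub' ((h₁.add h₂).add h₃) h₄,
    ← integral_sub' (((h₁.add h₂).add h₃).sub h₄) h₅,
    ← integral_add' ((((h₁.add h₂).add h₃).sub h₄).sub h₅) h₆]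
  refine setIntegral_nonneg measurableSet_Ioi fun t (ht : 0 < t) => ?_
  have e₁ : t ^ (a + 2 * s - 1) = t ^ (a - 1) * (t ^ s) ^ 2 := by
    rw [show a + 2 * s - 1 = a - 1 + s + s by ring, Real.rpow_add ht, Real.rpow_add ht]; ring
  have e₃ : t ^ (a + 2 - 1) = t ^ (a - 1) * t ^ 2 := by
    rw [show a + 2 - 1 = a - 1 + 1 + 1 by ring, Real.rpow_add ht, Real.rpow_add ht,
      Real.rpow_one]; ring
  have e₄ : t ^ (a + s - 1) = t ^ (a - 1) * t ^ s := by
    rw [show a + s - 1 = a - 1 + s by ring, Real.rpow_add ht]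
  have e₅ : t ^ (a + s + 1 - 1) = t ^ (a - 1) * t ^ s * t := by
    rw [show a + s + 1 - 1 = a - 1 + s + 1 by ring, Real.rpow_add ht, Real.rpow_add ht,
      Real.rpow_one]
  have e₆ : t ^ (a + 1 - 1) = t ^ (a - 1) * t := by
    rw [show a + 1 - 1 = a - 1 + 1 by ring, Real.rpow_add ht, Real.rpow_one]
  have key : 0 ≤ Real.exp (-t) * t ^ (a - 1) * (t ^ s - A - B * t) ^ 2 := by positivity
  simp only [Pi.add_apply, Pi.sub_apply, e₁, e₃, e₄, e₅, e₆]
  linarith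

theorem Gamma_three_halves : Real.Gamma (1 / 2 + 1) = √Real.pi / 2 := by
  rw [Real.Gamma_add_one (by norm_num), Real.Gamma_one_half_eq]; ring

theorem Gamma_five_halves : Real.Gamma (1 / 2 + 2) = 3 * √Real.pi / 4 := by
  rw [show (1 / 2 + 2 : ℝ) = 1 / 2 + 1 + 1 by norm_num, Real.Gamma_add_one (by norm_num),
    Gamma_three_halves]; ring

theorem Gamma_sq_le_sqrt_pi_mul_Gamma {s : ℝ} (hs : 0 < s) :
    (1 + 2 * s ^ 2) * Real.Gamma (1 / 2 + s) ^ 2 ≤ √Real.pi * Real.Gamma (1 / 2 + 2 * s) := by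
  have hP : 0 < √Real.pi := Real.sqrt_pos.2 Real.pi_pos
  have h := gamma_quadratic_form_nonneg one_half_pos hs
    ((1 - s) * Real.Gamma (1 / 2 + s) / √Real.pi) (2 * s * Real.Gamma (1 / 2 + s) / √Real.pi)
  rw [Gamma_three_halves, Gamma_five_halves, Real.Gamma_one_half_eq,
    Real.Gamma_add_one (s := 1 / 2 + s) (by positivity)] at h
  generalize Real.Gamma (1 / 2 + 2 * s) = H at *
  generalize Real.Gamma (1 / 2 + s) = G at *
  have h' := mul_nonneg hP.le h
  field_simp at h'
  linarith

/-- For power estimating functions `k(x) = |x|^r` in the Gaussian case `β = 2`, the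
asymptotic variance constant `Σ²(r) = (m_{2r} − m_r²)/(r² m_r²)` satisfies
`Σ²(2) = 1/2` and `Σ²(r) ≥ 1/2` for every `r > 0`: the minimum value `1/2` is
attained at `r = 2`. -/
theorem power_variance_min :
    (stdAbsMoment (2 * 2) - stdAbsMoment 2 ^ 2) / (2 ^ 2 * stdAbsMoment 2 ^ 2)
      = 1 / 2 ∧
    ∀ r : ℝ, 0 < r →
      1 / 2 ≤ (stdAbsMoment (2 * r) - stdAbsMoment r ^ 2) /
        (r ^ 2 * stdAbsMoment r ^ 2) := by
  constructor
  · have h4 : stdAbsMoment (2 * 2) = 3 := by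
      rw [stdAbsMoment, show ((1 + 2 * 2) / 2 : ℝ) = 1 / 2 + 2 by norm_num, Gamma_five_halves,
        show (2 * 2 / 2 : ℝ) = (2 : ℕ) by norm_num, Real.rpow_natCast]
      field_simp
      norm_num
    have h2 : stdAbsMoment 2 = 1 := by
      rw [stdAbsMoment, show ((1 + 2) / 2 : ℝ) = 1 / 2 + 1 by norm_num, Gamma_three_halves,
        div_self two_ne_zero, Real.rpow_one]
      field_simp
    rw [h4, h2]
    norm_num
  · intro r hr
    have hP : 0 < √Real.pi := Real.sqrt_pos.2 Real.pi_pos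
    have hG : 0 < Real.Gamma ((1 + r) / 2) := Real.Gamma_pos_of_pos (by positivity)
    have hm : 0 < stdAbsMoment r := by rw [stdAbsMoment]; positivity
    have h := Gamma_sq_le_sqrt_pi_mul_Gamma (half_pos hr)
    rw [show 1 / 2 + r / 2 = (1 + r) / 2 by ring,
      show 1 / 2 + 2 * (r / 2) = (1 + 2 * r) / 2 by ring] at h
    have h2 : (2 : ℝ) ^ (2 * r / 2) = (2 ^ (r / 2)) ^ 2 := by
      rw [show 2 * r / 2 = r / 2 + r / 2 by ring, Real.rpow_add two_pos, sq]
    have hmoment : (1 + r ^ 2 / 2) * stdAbsMoment r ^ 2 ≤ stdAbsMoment (2 * r) := by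
      have := mul_le_mul_of_nonneg_left h (sq_nonneg ((2 : ℝ) ^ (r / 2) / √Real.pi))
      calc (1 + r ^ 2 / 2) * stdAbsMoment r ^ 2
          = ((2 : ℝ) ^ (r / 2) / √Real.pi) ^ 2
              * ((1 + 2 * (r / 2) ^ 2) * Real.Gamma ((1 + r) / 2) ^ 2) := by
            rw [stdAbsMoment]; ring
        _ ≤ _ := this
        _ = stdAbsMoment (2 * r) := by
            rw [stdAbsMoment, h2]; field_simp
    rw [le_div_iff₀ (by positivity)]
    linarith
end
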